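/- Assume condition (C1). Then the TIN-achievable GDoF region, i.e., the union ⋃_{S ⊆ K} P^TINA_S over all subsets S of K, equals the single convex polytope P^TINA_K. -/

import Mathlib

noncomputable def alphaP {ι : Type*} [DecidableEq ι] (α : ι → ι → ℝ) (i j : ι) : ℝ :=
  if i = j then 0 else α i j

/-- A matching of the complete bipartite graph on `S × S`: a set of pairs in which no two
pairs share the same first coordinate and no two pairs share the same second coordinate. -/
def IsMatching {ι : Type*} (S : Finset ι) (M : Finset (ι × ι)) : Prop :=
  M ⊆ S ×ˢ S ∧
  (∀ p ∈ M, ∀ q ∈ M, p.1 = q.1 → p = q) ∧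
  (∀ p ∈ M, ∀ q ∈ M, p.2 = q.2 → p = q)

/-- The maximum weight `w(M*_S)` of a matching of the complete bipartite graph on `S × S`
with weights `α'` (the empty matching is allowed, so `w(M*_S) = 0` when `|S| ≤ 1`
whenever `α'` has zero diagonal and is nonnegative). -/
noncomputable def wStar {ι : Type*} [DecidableEq ι] (α' : ι → ι → ℝ) (S : Finset ι) : ℝ :=
  letI := Classical.propDecidable
  ((S ×ˢ S).powerset.filter (fun M => IsMatching S M)).sup'
    ⟨∅, by simp [IsMatching, Finset.mem_filter]⟩ (fun M => ∑ p ∈ M, α' p.1 p.2)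

/-- The matching-form polyhedral TIN-achievable region `P^TINA_S`. -/
noncomputable def TINA {ι : Type*} [DecidableEq ι] (α : ι → ι → ℝ) (S : Finset ι)
    (d : ι → ℝ) : Prop :=
  (∀ i ∉ S, d i = 0) ∧ (∀ k ∈ S, 0 ≤ d k) ∧
  ∀ S' ⊆ S, S'.Nonempty → ∑ k ∈ S', d k ≤ ∑ k ∈ S', α k k - wStar (alphaP α) S'

/-- Condition (C1): for every `k`, `α_{kk} ≥ α_{ik} + α_{kj} − α'_{ij}` for all `i ≠ k`,
`j ≠ k`. -/
def CondC1 {ι : Type*} [DecidableEq ι] (α : ι → ι → ℝ) : Prop :=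
  ∀ k i j : ι, i ≠ k → j ≠ k → α i k + α k j - alphaP α i j ≤ α k k

/-- Condition (C2): every subset of size `> 2` admits a maximum-weight matching containing
a zero-strength pair. -/
def CondC2 {ι : Type*} [DecidableEq ι] (α : ι → ι → ℝ) : Prop :=
  ∀ S' : Finset ι, 2 < S'.card →
    ∃ M : Finset (ι × ι), IsMatching S' M ∧
      (∑ p ∈ M, alphaP α p.1 p.2) = wStar (alphaP α) S' ∧
      ∃ p ∈ M, α p.1 p.2 = 0

theorem IsMatching.sum_le_wStar {ι : Type*} [DecidableEq ι] (w : ι → ι → ℝ) {S : Finset ι}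
    {M : Finset (ι × ι)} (hM : IsMatching S M) : ∑ p ∈ M, w p.1 p.2 ≤ wStar w S := by
  classical
  unfold wStar
  refine Finset.le_sup' (fun M : Finset (ι × ι) => ∑ p ∈ M, w p.1 p.2) ?_
  exact Finset.mem_filter.2 ⟨Finset.mem_powerset.2 hM.1, hM⟩

theorem wStar_le {ι : Type*} [DecidableEq ι] {w : ι → ι → ℝ} {S : Finset ι} {c : ℝ}
    (h : ∀ M, IsMatching S M → ∑ p ∈ M, w p.1 p.2 ≤ c) : wStar w S ≤ c := by
  classical
  exact Finset.sup'_le _ _ fun M hM => h M (Finset.mem_filter.1 hM).2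

theorem wStar_empty {ι : Type*} [DecidableEq ι] (w : ι → ι → ℝ) : wStar w ∅ ≤ 0 := by
  refine wStar_le fun M hM => ?_
  have : M = ∅ := by simpa using hM.1
  simp [this]

/-- Deleting all edges at `k` from a matching on `insert k T` gives a matching on `T`. -/
theorem IsMatching.of_subset_avoiding {ι : Type*} [DecidableEq ι] {T : Finset ι} {k : ι}
    {M N : Finset (ι × ι)} (hM : IsMatching (insert k T) M) (hN : N ⊆ M)
    (h : ∀ p ∈ N, p.1 ≠ k ∧ p.2 ≠ k) : IsMatching T N := by
  refine ⟨fun p hp => ?_, fun p hp q hq => hM.2.1 p (hN hp) q (hN hq),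
    fun p hp q hq => hM.2.2 p (hN hp) q (hN hq)⟩
  have h1 := Finset.mem_product.1 (hM.1 (hN hp))
  have h2 := h p hp
  simp only [Finset.mem_insert] at h1
  exact Finset.mem_product.2 ⟨h1.1.resolve_left h2.1, h1.2.resolve_left h2.2⟩

theorem alphaP_nonneg {ι : Type*} [DecidableEq ι] {α : ι → ι → ℝ} (hα : ∀ i j, 0 ≤ α i j)
    (i j : ι) : 0 ≤ alphaP α i j := by
  unfold alphaP
  split_ifs
  exacts [le_rfl, hα i j]

/-- Under (C1), adding the user `k` raises the maximum matching weight by at most `α k k`. -/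
theorem CondC1.wStar_insert_le {ι : Type*} [DecidableEq ι] {α : ι → ι → ℝ}
    (hα : ∀ i j, 0 ≤ α i j) (hC1 : CondC1 α) (T : Finset ι) (k : ι) :
    wStar (alphaP α) (insert k T) ≤ wStar (alphaP α) T + α k k := by
  refine wStar_le fun M hM => ?_
  have hrow : ∀ a b, (k, a) ∈ M → (k, b) ∈ M → a = b := fun a b ha hb =>
    congrArg Prod.snd (hM.2.1 _ ha _ hb rfl)
  have hcol : ∀ a b, (a, k) ∈ M → (b, k) ∈ M → a = b := fun a b ha hb =>
    congrArg Prod.fst (hM.2.2 _ ha _ hb rfl)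
  by_cases hin : ∃ i, (i, k) ∈ M
  · obtain ⟨i, hi⟩ := hin
    rw [← Finset.add_sum_erase _ _ hi]
    by_cases hout : ∃ j, (k, j) ∈ M.erase (i, k)
    · obtain ⟨j, hj'⟩ := hout
      rw [← Finset.add_sum_erase _ _ hj']
      obtain ⟨hne, hj⟩ := Finset.mem_erase.1 hj'
      have hik : i ≠ k := by
        rintro rfl
        exact hne (Prod.ext rfl (hrow _ _ hj hi))
      have hjk : j ≠ k := by
        rintro rfl
        exact hne (Prod.ext (hcol _ _ hj hi) rfl)
      set N := (M.erase (i, k)).erase (k, j) with hNdef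
      have hNM : N ⊆ M := (Finset.erase_subset _ _).trans (Finset.erase_subset _ _)
      have hN : IsMatching T N := by
        refine hM.of_subset_avoiding hNM ?_
        rintro ⟨a, b⟩ hp
        simp only [hNdef, Finset.mem_erase] at hp
        constructor
        · rintro rfl
          exact hp.1 (Prod.ext rfl (hrow _ _ hp.2.2 hj))
        · rintro rfl
          exact hp.2.1 (Prod.ext (hcol _ _ hp.2.2 hi) rfl)
      have hrow_i : ∀ p ∈ N, p.1 ≠ i := by
        intro p hp h
        have := hM.2.1 p (hNM hp) (i, k) hi h
        subst this
        simp [hNdef] at hp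
      have hcol_j : ∀ p ∈ N, p.2 ≠ j := by
        intro p hp h
        have := hM.2.2 p (hNM hp) (k, j) hj h
        subst this
        simp [hNdef] at hp
      have hiT : i ∈ T :=
        (Finset.mem_insert.1 (Finset.mem_product.1 (hM.1 hi)).1).resolve_left hik
      have hjT : j ∈ T :=
        (Finset.mem_insert.1 (Finset.mem_product.1 (hM.1 hj)).2).resolve_left hjk
      have hshort : IsMatching T (insert (i, j) N) := by
        refine ⟨Finset.insert_subset (Finset.mem_product.2 ⟨hiT, hjT⟩) hN.1, ?_, ?_⟩
        · intro p hp q hq h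
          rcases Finset.mem_insert.1 hp with rfl | hp <;>
            rcases Finset.mem_insert.1 hq with rfl | hq
          · rfl
          · exact absurd h.symm (hrow_i q hq)
          · exact absurd h (hrow_i p hp)
          · exact hN.2.1 p hp q hq h
        · intro p hp q hq h
          rcases Finset.mem_insert.1 hp with rfl | hp <;>
            rcases Finset.mem_insert.1 hq with rfl | hq
          · rfl
          · exact absurd h.symm (hcol_j q hq)
          · exact absurd h (hcol_j p hp)
          · exact hN.2.2 p hp q hq h
      have hle := hshort.sum_le_wStar (alphaP α)
      rw [Finset.sum_insert fun h => hrow_i _ h rfl] at hle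
      have hc := hC1 k i j hik hjk
      have e1 : alphaP α i k = α i k := if_neg hik
      have e2 : alphaP α k j = α k j := if_neg hjk.symm
      dsimp only at hle ⊢
      linarith
    · have hN : IsMatching T (M.erase (i, k)) := by
        refine hM.of_subset_avoiding (Finset.erase_subset _ _) ?_
        rintro ⟨a, b⟩ hp
        constructor
        · rintro rfl
          exact hout ⟨b, hp⟩
        · rintro rfl
          obtain ⟨hne, hp⟩ := Finset.mem_erase.1 hp
          exact hne (Prod.ext (hcol _ _ hp hi) rfl)
      have hle := hN.sum_le_wStar (alphaP α)
      have hw : alphaP α i k ≤ α k k := by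
        unfold alphaP
        split_ifs with hik
        · exact hα k k
        · have hc := hC1 k i i hik hik
          simp only [alphaP, if_true] at hc
          linarith [hα k i]
      dsimp only at hle ⊢
      linarith
  · by_cases hout : ∃ j, (k, j) ∈ M
    · obtain ⟨j, hj⟩ := hout
      rw [← Finset.add_sum_erase _ _ hj]
      have hN : IsMatching T (M.erase (k, j)) := by
        refine hM.of_subset_avoiding (Finset.erase_subset _ _) ?_
        rintro ⟨a, b⟩ hp
        obtain ⟨hne, hpM⟩ := Finset.mem_erase.1 hp
        constructor
        · rintro rfl
          exact hne (Prod.ext rfl (hrow _ _ hpM hj))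
        · rintro rfl
          exact hin ⟨a, hpM⟩
      have hle := hN.sum_le_wStar (alphaP α)
      have hjk : j ≠ k := by
        rintro rfl
        exact hin ⟨_, hj⟩
      have hc := hC1 k j j hjk hjk
      have e : alphaP α k j = α k j := if_neg hjk.symm
      simp only [alphaP, if_true] at hc
      dsimp only at hle ⊢
      linarith [hα j k]
    · have hN : IsMatching T M := by
        refine hM.of_subset_avoiding subset_rfl ?_
        rintro ⟨a, b⟩ hp
        constructor
        · rintro rfl
          exact hout ⟨b, hp⟩
        · rintro rfl
          exact hin ⟨a, hp⟩
      linarith [hN.sum_le_wStar (alphaP α), hα k k]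

/-- Under (C1), the right-hand side of the sum bounds is monotone in the user set. -/
theorem CondC1.sum_sub_wStar_mono {ι : Type*} [DecidableEq ι] {α : ι → ι → ℝ}
    (hα : ∀ i j, 0 ≤ α i j) (hC1 : CondC1 α) :
    Monotone fun T : Finset ι => ∑ k ∈ T, α k k - wStar (alphaP α) T := by
  have key : ∀ T U : Finset ι, Disjoint U T → ∑ k ∈ T, α k k - wStar (alphaP α) T ≤
      ∑ k ∈ U ∪ T, α k k - wStar (alphaP α) (U ∪ T) := by
    intro T U
    induction U using Finset.induction_on with
    | empty => simp
    | insert k U hk ih =>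
      intro hd
      obtain ⟨hkT, hd⟩ := Finset.disjoint_insert_left.1 hd
      rw [Finset.insert_union, Finset.sum_insert (by simp [hk, hkT])]
      linarith [ih hd, hC1.wStar_insert_le hα (U ∪ T) k]
  intro T V hTV
  simpa [Finset.sdiff_union_of_subset hTV] using key T (V \ T) Finset.sdiff_disjoint

/-- Under condition (C1), the TIN-achievable GDoF region, i.e. the union
of the polytopes `P^TINA_S` over all subsets `S` of the index set, equals the single
convex polytope `P^TINA_K` of the full user set. -/
theorem tina_union_eq_full_of_C1 {ι : Type*} [Fintype ι] [DecidableEq ι]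
    (α : ι → ι → ℝ) (hα : ∀ i j, 0 ≤ α i j) (hC1 : CondC1 α) :
    ∀ d : ι → ℝ, (∃ S : Finset ι, TINA α S d) ↔ TINA α Finset.univ d := by
  intro d
  refine ⟨?_, fun h => ⟨_, h⟩⟩
  rintro ⟨S, h0, hpos, hsum⟩
  refine ⟨fun i hi => absurd (Finset.mem_univ i) hi, fun k _ => ?_, fun S' _ _ => ?_⟩
  · by_cases hk : k ∈ S
    · exact hpos k hk
    · exact (h0 k hk).ge
  · have hd : ∑ k ∈ S' ∩ S, d k = ∑ k ∈ S', d k :=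
      Finset.sum_subset Finset.inter_subset_left fun k hk hkS =>
        h0 k fun h => hkS (Finset.mem_inter.2 ⟨hk, h⟩)
    have hmono := hC1.sum_sub_wStar_mono hα (Finset.inter_subset_left : S' ∩ S ⊆ S')
    rw [← hd]
    refine le_trans ?_ hmono
    rcases (S' ∩ S).eq_empty_or_nonempty with he | hne
    · simpa [he] using wStar_empty (alphaP α)
    · exact hsum _ Finset.inter_subset_right hne
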